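/- arXiv:2410.05552 — 2 statements merged into one kernel-verified Lean document; each statement's English description precedes it below -/
import Mathlib

section
/- Under the sequential experiment without covariates, E[(τ̂₂ − τ)²] = (1/n²) Σ_{i=1}^n E[ (σ⁽¹⁾)²/e_i + (σ⁽⁰⁾)²/(1 − e_i) ]; in particular, if every e_i equals the constant e* = σ⁽¹⁾/(σ⁽¹⁾+σ⁽⁰⁾), then E[(τ̂* − τ)²] = (σ⁽¹⁾ + σ⁽⁰⁾)²/n. -/
open MeasureTheory ProbabilityTheory
open scoped ENNReal

namespace AdaptiveExperiment

/-- The intermediary estimator `τ̂₂` of the average treatment effect `τ = μ1 - μ0`,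
built from the collected data `(Wᵢ, Yᵢ)` and the propensity scores `eᵢ`. -/
noncomputable def tauHat2 {Ω : Type*} (n : ℕ) (μ1 μ0 : ℝ)
    (W Y e : Fin n → Ω → ℝ) (ω : Ω) : ℝ :=
  (μ1 - μ0) + (1 / (n : ℝ)) * ∑ i : Fin n,
    ((Y i ω - μ1) * W i ω / e i ω - (Y i ω - μ0) * (1 - W i ω) / (1 - e i ω))

/-- A sequential (possibly adaptive) experiment without covariates, with `n` units,
arm means `μ1, μ0`, arm standard deviations `σ1, σ0 > 0`, filtration `F`
(`F k` is the σ-algebra generated by the data of the first `k` units),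
treatment indicators `W`, outcomes `Y`, and propensity scores `e`. -/
structure IsSeqExp {Ω : Type*} [m0 : MeasurableSpace Ω] (P : Measure Ω) (n : ℕ)
    (μ1 μ0 σ1 σ0 : ℝ) (F : ℕ → MeasurableSpace Ω)
    (W Y e : Fin n → Ω → ℝ) : Prop where
  isProb : IsProbabilityMeasure P
  sigma1_pos : 0 < σ1
  sigma0_pos : 0 < σ0
  F_mono : Monotone F
  F_le : ∀ k, F k ≤ m0
  /-- treatments are binary (coded as real numbers `0` and `1`) -/
  W_bool : ∀ i ω, W i ω = 0 ∨ W i ω = 1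
  /-- propensity scores take values in `(0,1)` -/
  e_mem : ∀ i ω, e i ω ∈ Set.Ioo (0 : ℝ) 1
  /-- `eᵢ` is `𝓕_{i-1}`-measurable -/
  e_meas : ∀ i : Fin n, Measurable[F i.val] (e i)
  /-- the data of unit `i` is `𝓕ᵢ`-measurable -/
  W_meas : ∀ i : Fin n, Measurable[F (i.val + 1)] (W i)
  Y_meas : ∀ i : Fin n, Measurable[F (i.val + 1)] (Y i)
  /-- `P(Wᵢ = 1 | 𝓕_{i-1}) = eᵢ` -/
  W_condexp : ∀ i : Fin n, P[W i|F i.val] =ᵐ[P] e i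
  /-- conditionally on `𝓕_{i-1}` and `Wᵢ`, the outcome `Yᵢ` has mean `μ^{(Wᵢ)}` -/
  Y_mean : ∀ i : Fin n,
    P[Y i|F i.val ⊔ MeasurableSpace.comap (W i) (inferInstance : MeasurableSpace ℝ)]
      =ᵐ[P] fun ω => μ1 * W i ω + μ0 * (1 - W i ω)
  /-- conditionally on `𝓕_{i-1}` and `Wᵢ`, the outcome `Yᵢ` has variance `(σ^{(Wᵢ)})²` -/
  Y_var : ∀ i : Fin n,
    P[(fun ω => (Y i ω - (μ1 * W i ω + μ0 * (1 - W i ω))) ^ 2)|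
        F i.val ⊔ MeasurableSpace.comap (W i) (inferInstance : MeasurableSpace ℝ)]
      =ᵐ[P] fun ω => σ1 ^ 2 * W i ω + σ0 ^ 2 * (1 - W i ω)
  /-- integrability of all the squares appearing in the analysis -/
  int_Y_sq : ∀ i : Fin n, Integrable (fun ω => (Y i ω) ^ 2) P
  int_term_sq : ∀ i : Fin n, Integrable
    (fun ω => ((Y i ω - μ1) * W i ω / e i ω
      - (Y i ω - μ0) * (1 - W i ω) / (1 - e i ω)) ^ 2) P
  int_inv_e_sq : ∀ i : Fin n, Integrable (fun ω => 1 / e i ω ^ 2) P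
  int_inv_one_sub_e_sq : ∀ i : Fin n, Integrable (fun ω => 1 / (1 - e i ω) ^ 2) P

/-- Inside an integral, `g` may be replaced by its conditional expectation given `m` when it is
multiplied by an `m`-measurable factor. -/
theorem integral_mul_eq_of_condExp_ae_eq {Ω : Type*} {m m0 : MeasurableSpace Ω}
    {P : Measure Ω} [IsFiniteMeasure P] (hm : m ≤ m0) {f g h : Ω → ℝ}
    (hf : StronglyMeasurable[m] f) (hfg : Integrable (fun ω => f ω * g ω) P)
    (hg : Integrable g P) (hgh : P[g|m] =ᵐ[P] h) :
    ∫ ω, f ω * g ω ∂P = ∫ ω, f ω * h ω ∂P := by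
  rw [← integral_condExp hm (f := fun ω => f ω * g ω)]
  refine integral_congr_ae ?_
  filter_upwards [condExp_mul_of_stronglyMeasurable_left hf hfg hg, hgh] with ω h1 h2
  rw [← h2]
  exact h1

/-- The summand of the intermediary estimator for a single unit. -/
noncomputable def ipwTerm {Ω : Type*} (μ1 μ0 : ℝ) (W Y e : Ω → ℝ) (ω : Ω) : ℝ :=
  (Y ω - μ1) * W ω / e ω - (Y ω - μ0) * (1 - W ω) / (1 - e ω)

/-- The signed inverse propensity weight. -/
noncomputable def ipwWeight {Ω : Type*} (W e : Ω → ℝ) (ω : Ω) : ℝ :=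
  W ω / e ω - (1 - W ω) / (1 - e ω)

theorem ipwTerm_eq_weight_mul {Ω : Type*} (μ1 μ0 : ℝ) {W Y e : Ω → ℝ} {ω : Ω}
    (hW : W ω = 0 ∨ W ω = 1) :
    ipwTerm μ1 μ0 W Y e ω
      = ipwWeight W e ω * (Y ω - (μ1 * W ω + μ0 * (1 - W ω))) := by
  unfold ipwTerm ipwWeight
  rcases hW with h | h <;> rw [h] <;> ring

namespace IsSeqExp

variable {Ω : Type*} [m0 : MeasurableSpace Ω] {P : Measure Ω} {n : ℕ}
  {μ1 μ0 σ1 σ0 : ℝ} {F : ℕ → MeasurableSpace Ω} {W Y e : Fin n → Ω → ℝ}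

theorem sup_comap_le (h : IsSeqExp P n μ1 μ0 σ1 σ0 F W Y e) (i : Fin n) :
    F i.val ⊔ MeasurableSpace.comap (W i) (inferInstance : MeasurableSpace ℝ) ≤ m0 :=
  sup_le (h.F_le _) ((h.W_meas i).comap_le.trans (h.F_le _))

theorem measurable_weight (h : IsSeqExp P n μ1 μ0 σ1 σ0 F W Y e) (i : Fin n) :
    Measurable[F i.val ⊔ MeasurableSpace.comap (W i) (inferInstance : MeasurableSpace ℝ)]
      (ipwWeight (W i) (e i)) := by
  have he : Measurable[F i.val ⊔ MeasurableSpace.comap (W i)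
      (inferInstance : MeasurableSpace ℝ)] (e i) :=
    (h.e_meas i).mono le_sup_left le_rfl
  have hW : Measurable[F i.val ⊔ MeasurableSpace.comap (W i)
      (inferInstance : MeasurableSpace ℝ)] (W i) :=
    (comap_measurable (W i)).mono le_sup_right le_rfl
  exact (hW.div he).sub ((measurable_const.sub hW).div (measurable_const.sub he))

theorem measurable_term (h : IsSeqExp P n μ1 μ0 σ1 σ0 F W Y e) (i : Fin n) :
    Measurable[F (i.val + 1)] (ipwTerm μ1 μ0 (W i) (Y i) (e i)) := by
  have he : Measurable[F (i.val + 1)] (e i) :=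
    (h.e_meas i).mono (h.F_mono (Nat.le_succ _)) le_rfl
  have hW := h.W_meas i
  have hY := h.Y_meas i
  exact (((hY.sub measurable_const).mul hW).div he).sub
    (((hY.sub measurable_const).mul (measurable_const.sub hW)).div (measurable_const.sub he))

theorem memLp_term (h : IsSeqExp P n μ1 μ0 σ1 σ0 F W Y e) (i : Fin n) :
    MemLp (ipwTerm μ1 μ0 (W i) (Y i) (e i)) 2 P :=
  (memLp_two_iff_integrable_sq
    ((h.measurable_term i).mono (h.F_le _) le_rfl).aestronglyMeasurable).2 (h.int_term_sq i)

theorem memLp_treatment (h : IsSeqExp P n μ1 μ0 σ1 σ0 F W Y e) (i : Fin n) :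
    MemLp (W i) 2 P := by
  have := h.isProb
  refine MemLp.of_bound ((h.W_meas i).mono (h.F_le _) le_rfl).aestronglyMeasurable 1
    (ae_of_all _ fun ω => ?_)
  rcases h.W_bool i ω with hw | hw <;> simp [hw]

theorem memLp_mean (h : IsSeqExp P n μ1 μ0 σ1 σ0 F W Y e) (i : Fin n) :
    MemLp (fun ω => μ1 * W i ω + μ0 * (1 - W i ω)) 2 P := by
  have := h.isProb
  exact ((h.memLp_treatment i).const_mul μ1).add
    (((memLp_const 1).sub (h.memLp_treatment i)).const_mul μ0)

theorem memLp_outcome (h : IsSeqExp P n μ1 μ0 σ1 σ0 F W Y e) (i : Fin n) :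
    MemLp (Y i) 2 P :=
  (memLp_two_iff_integrable_sq
    ((h.Y_meas i).mono (h.F_le _) le_rfl).aestronglyMeasurable).2 (h.int_Y_sq i)

theorem memLp_residual (h : IsSeqExp P n μ1 μ0 σ1 σ0 F W Y e) (i : Fin n) :
    MemLp (fun ω => Y i ω - (μ1 * W i ω + μ0 * (1 - W i ω))) 2 P :=
  (h.memLp_outcome i).sub (h.memLp_mean i)

theorem condExp_residual (h : IsSeqExp P n μ1 μ0 σ1 σ0 F W Y e) (i : Fin n) :
    P[(fun ω => Y i ω - (μ1 * W i ω + μ0 * (1 - W i ω)))|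
        F i.val ⊔ MeasurableSpace.comap (W i) (inferInstance : MeasurableSpace ℝ)]
      =ᵐ[P] fun _ => 0 := by
  have := h.isProb
  have hW : Measurable[F i.val ⊔ MeasurableSpace.comap (W i)
      (inferInstance : MeasurableSpace ℝ)] (W i) :=
    (comap_measurable (W i)).mono le_sup_right le_rfl
  have hmean : StronglyMeasurable[F i.val ⊔ MeasurableSpace.comap (W i)
      (inferInstance : MeasurableSpace ℝ)] (fun ω => μ1 * W i ω + μ0 * (1 - W i ω)) :=
    ((hW.const_mul μ1).add ((measurable_const.sub hW).const_mul μ0)).stronglyMeasurable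
  have hint := (h.memLp_mean i).integrable one_le_two
  have hsub := condExp_sub ((h.memLp_outcome i).integrable one_le_two) hint
    (F i.val ⊔ MeasurableSpace.comap (W i) (inferInstance : MeasurableSpace ℝ))
  rw [condExp_of_stronglyMeasurable (h.sup_comap_le i) hmean hint] at hsub
  filter_upwards [hsub, h.Y_mean i] with ω h1 h2
  refine h1.trans ?_
  simp [h2]

theorem integral_term_mul_term_of_lt (h : IsSeqExp P n μ1 μ0 σ1 σ0 F W Y e) {i j : Fin n}
    (hij : i < j) :
    ∫ ω, ipwTerm μ1 μ0 (W i) (Y i) (e i) ω * ipwTerm μ1 μ0 (W j) (Y j) (e j) ω ∂P = 0 := by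
  have := h.isProb
  have hterm := (h.measurable_term i).mono
    ((h.F_mono (Nat.succ_le_of_lt hij)).trans (le_sup_left
      (b := MeasurableSpace.comap (W j) (inferInstance : MeasurableSpace ℝ)))) le_rfl
  have heq : ∀ ω, ipwTerm μ1 μ0 (W i) (Y i) (e i) ω * ipwTerm μ1 μ0 (W j) (Y j) (e j) ω
      = (ipwTerm μ1 μ0 (W i) (Y i) (e i) ω * ipwWeight (W j) (e j) ω)
        * (Y j ω - (μ1 * W j ω + μ0 * (1 - W j ω))) := fun ω => by
    rw [ipwTerm_eq_weight_mul μ1 μ0 (h.W_bool j ω), mul_assoc]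
  have hint := (h.memLp_term i).integrable_mul (h.memLp_term j)
  simp_rw [heq]
  rw [integral_mul_eq_of_condExp_ae_eq (h.sup_comap_le j)
    (f := fun ω => ipwTerm μ1 μ0 (W i) (Y i) (e i) ω * ipwWeight (W j) (e j) ω)
    (hterm.mul (h.measurable_weight j)).stronglyMeasurable
    (hint.congr (ae_of_all _ heq)) ((h.memLp_residual j).integrable one_le_two)
    (h.condExp_residual j)]
  simp

theorem integral_term_mul_term_of_ne (h : IsSeqExp P n μ1 μ0 σ1 σ0 F W Y e) {i j : Fin n}
    (hij : i ≠ j) :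
    ∫ ω, ipwTerm μ1 μ0 (W i) (Y i) (e i) ω * ipwTerm μ1 μ0 (W j) (Y j) (e j) ω ∂P = 0 := by
  rcases lt_or_gt_of_ne hij with hlt | hlt
  · exact h.integral_term_mul_term_of_lt hlt
  · simp_rw [mul_comm (ipwTerm μ1 μ0 (W i) (Y i) (e i) _)]
    exact h.integral_term_mul_term_of_lt hlt

theorem integrable_sq_inv_mul_treatment (h : IsSeqExp P n μ1 μ0 σ1 σ0 F W Y e) (i : Fin n) :
    Integrable (fun ω => 1 / e i ω ^ 2 * W i ω) P := by
  refine (h.int_inv_e_sq i).mul_bdd (c := 1)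
    ((h.W_meas i).mono (h.F_le _) le_rfl).aestronglyMeasurable (ae_of_all _ fun ω => ?_)
  rcases h.W_bool i ω with hw | hw <;> simp [hw]

theorem integrable_sq_inv_mul_control (h : IsSeqExp P n μ1 μ0 σ1 σ0 F W Y e) (i : Fin n) :
    Integrable (fun ω => 1 / (1 - e i ω) ^ 2 * (1 - W i ω)) P := by
  refine (h.int_inv_one_sub_e_sq i).mul_bdd (c := 1)
    (measurable_const.sub ((h.W_meas i).mono (h.F_le _) le_rfl)).aestronglyMeasurable
    (ae_of_all _ fun ω => ?_)
  rcases h.W_bool i ω with hw | hw <;> simp [hw]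

theorem integral_sq_inv_mul_treatment (h : IsSeqExp P n μ1 μ0 σ1 σ0 F W Y e) (i : Fin n) :
    ∫ ω, 1 / e i ω ^ 2 * W i ω ∂P = ∫ ω, 1 / e i ω ∂P := by
  have := h.isProb
  rw [integral_mul_eq_of_condExp_ae_eq (h.F_le i.val) (f := fun ω => 1 / e i ω ^ 2)
    (measurable_const.div ((h.e_meas i).pow_const 2)).stronglyMeasurable
    (h.integrable_sq_inv_mul_treatment i) ((h.memLp_treatment i).integrable one_le_two)
    (h.W_condexp i)]
  refine integral_congr_ae (ae_of_all _ fun ω => ?_)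
  have := (h.e_mem i ω).1.ne'
  field_simp

theorem integral_sq_inv_mul_control (h : IsSeqExp P n μ1 μ0 σ1 σ0 F W Y e) (i : Fin n) :
    ∫ ω, 1 / (1 - e i ω) ^ 2 * (1 - W i ω) ∂P = ∫ ω, 1 / (1 - e i ω) ∂P := by
  have := h.isProb
  have hW := (h.memLp_treatment i).integrable one_le_two
  have hc : P[(fun ω => 1 - W i ω)|F i.val] =ᵐ[P] fun ω => 1 - e i ω := by
    have hsub := condExp_sub (integrable_const (1 : ℝ)) hW (F i.val)
    rw [condExp_const (h.F_le _)] at hsub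
    filter_upwards [hsub, h.W_condexp i] with ω h1 h2
    refine h1.trans ?_
    simp [h2]
  rw [integral_mul_eq_of_condExp_ae_eq (h.F_le i.val) (f := fun ω => 1 / (1 - e i ω) ^ 2)
    (measurable_const.div ((measurable_const.sub (h.e_meas i)).pow_const 2)).stronglyMeasurable
    (h.integrable_sq_inv_mul_control i) ((integrable_const 1).sub hW) hc]
  refine integral_congr_ae (ae_of_all _ fun ω => ?_)
  have := (sub_pos.2 (h.e_mem i ω).2).ne'
  field_simp

theorem integrable_inv_propensity (h : IsSeqExp P n μ1 μ0 σ1 σ0 F W Y e) (i : Fin n) :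
    Integrable (fun ω => 1 / e i ω) P := by
  have := h.isProb
  have hm : Measurable (fun ω => 1 / e i ω) :=
    measurable_const.div ((h.e_meas i).mono (h.F_le _) le_rfl)
  refine ((memLp_two_iff_integrable_sq hm.aestronglyMeasurable).2 ?_).integrable one_le_two
  simpa only [div_pow, one_pow] using h.int_inv_e_sq i

theorem integrable_inv_one_sub_propensity (h : IsSeqExp P n μ1 μ0 σ1 σ0 F W Y e) (i : Fin n) :
    Integrable (fun ω => 1 / (1 - e i ω)) P := by
  have := h.isProb
  have hm : Measurable (fun ω => 1 / (1 - e i ω)) :=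
    measurable_const.div (measurable_const.sub ((h.e_meas i).mono (h.F_le _) le_rfl))
  refine ((memLp_two_iff_integrable_sq hm.aestronglyMeasurable).2 ?_).integrable one_le_two
  simpa only [div_pow, one_pow] using h.int_inv_one_sub_e_sq i

theorem integral_term_sq (h : IsSeqExp P n μ1 μ0 σ1 σ0 F W Y e) (i : Fin n) :
    ∫ ω, ipwTerm μ1 μ0 (W i) (Y i) (e i) ω ^ 2 ∂P
      = ∫ ω, (σ1 ^ 2 / e i ω + σ0 ^ 2 / (1 - e i ω)) ∂P := by
  have := h.isProb
  have heq : ∀ ω, ipwTerm μ1 μ0 (W i) (Y i) (e i) ω ^ 2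
      = ipwWeight (W i) (e i) ω ^ 2 * (Y i ω - (μ1 * W i ω + μ0 * (1 - W i ω))) ^ 2 :=
    fun ω => by rw [ipwTerm_eq_weight_mul μ1 μ0 (h.W_bool i ω), mul_pow]
  have hweight : ∀ ω, ipwWeight (W i) (e i) ω ^ 2 * (σ1 ^ 2 * W i ω + σ0 ^ 2 * (1 - W i ω))
      = σ1 ^ 2 * (1 / e i ω ^ 2 * W i ω) + σ0 ^ 2 * (1 / (1 - e i ω) ^ 2 * (1 - W i ω)) :=
    fun ω => by
      unfold ipwWeight
      rcases h.W_bool i ω with hw | hw <;> simp [hw, mul_comm]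
  have hint : Integrable (fun ω => ipwTerm μ1 μ0 (W i) (Y i) (e i) ω ^ 2) P :=
    h.int_term_sq i
  simp_rw [heq]
  rw [integral_mul_eq_of_condExp_ae_eq (h.sup_comap_le i)
    ((h.measurable_weight i).pow_const 2).stronglyMeasurable
    (hint.congr (ae_of_all _ heq)) (h.memLp_residual i).integrable_sq (h.Y_var i)]
  simp_rw [hweight]
  rw [integral_add ((h.integrable_sq_inv_mul_treatment i).const_mul _)
      ((h.integrable_sq_inv_mul_control i).const_mul _),
    integral_const_mul, integral_const_mul, h.integral_sq_inv_mul_treatment,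
    h.integral_sq_inv_mul_control, ← integral_const_mul, ← integral_const_mul,
    ← integral_add ((h.integrable_inv_propensity i).const_mul _)
      ((h.integrable_inv_one_sub_propensity i).const_mul _)]
  simp only [mul_one_div]

theorem integral_tauHat2_sub_sq (h : IsSeqExp P n μ1 μ0 σ1 σ0 F W Y e) :
    ∫ ω, (tauHat2 n μ1 μ0 W Y e ω - (μ1 - μ0)) ^ 2 ∂P =
      (1 / (n : ℝ) ^ 2) * ∑ i : Fin n,
        ∫ ω, (σ1 ^ 2 / e i ω + σ0 ^ 2 / (1 - e i ω)) ∂P := by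
  have hexpand : ∀ ω, (tauHat2 n μ1 μ0 W Y e ω - (μ1 - μ0)) ^ 2 = (1 / (n : ℝ) ^ 2) *
      ∑ i : Fin n, ∑ j : Fin n,
        ipwTerm μ1 μ0 (W i) (Y i) (e i) ω * ipwTerm μ1 μ0 (W j) (Y j) (e j) ω := fun ω => by
    rw [← Finset.sum_mul_sum]
    simp only [tauHat2, ipwTerm]
    ring
  have hint : ∀ i j : Fin n, Integrable (fun ω =>
      ipwTerm μ1 μ0 (W i) (Y i) (e i) ω * ipwTerm μ1 μ0 (W j) (Y j) (e j) ω) P :=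
    fun i j => (h.memLp_term i).integrable_mul (h.memLp_term j)
  simp_rw [hexpand]
  rw [integral_const_mul,
    integral_finsetSum _ fun i _ => integrable_finsetSum _ fun j _ => hint i j]
  congr 1
  refine Finset.sum_congr rfl fun i _ => ?_
  rw [integral_finsetSum _ fun j _ => hint i j, Finset.sum_eq_single i
    (fun j _ hj => h.integral_term_mul_term_of_ne hj.symm) (by simp), ← h.integral_term_sq i]
  simp only [sq]

end IsSeqExp

/-- In the sequential experiment without covariates,
`E[(τ̂₂ − τ)²] = (1/n²) Σᵢ E[(σ⁽¹⁾)²/eᵢ + (σ⁽⁰⁾)²/(1 − eᵢ)]`; in particular if every `eᵢ`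
equals the Neyman propensity `e* = σ⁽¹⁾/(σ⁽¹⁾+σ⁽⁰⁾)` then `E[(τ̂* − τ)²] = (σ⁽¹⁾+σ⁽⁰⁾)²/n`. -/
theorem statement_1 {Ω : Type*} [MeasurableSpace Ω] (P : Measure Ω)
    (n : ℕ) (hn : 1 ≤ n) (μ1 μ0 σ1 σ0 : ℝ)
    (F : ℕ → MeasurableSpace Ω) (W Y e : Fin n → Ω → ℝ)
    (hExp : IsSeqExp P n μ1 μ0 σ1 σ0 F W Y e) :
    (∫ ω, (tauHat2 n μ1 μ0 W Y e ω - (μ1 - μ0)) ^ 2 ∂P =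
      (1 / (n : ℝ) ^ 2) * ∑ i : Fin n,
        ∫ ω, (σ1 ^ 2 / e i ω + σ0 ^ 2 / (1 - e i ω)) ∂P) ∧
    ((∀ i ω, e i ω = σ1 / (σ1 + σ0)) →
      ∫ ω, (tauHat2 n μ1 μ0 W Y e ω - (μ1 - μ0)) ^ 2 ∂P = (σ1 + σ0) ^ 2 / n) := by
  refine ⟨hExp.integral_tauHat2_sub_sq, fun he => ?_⟩
  have := hExp.isProb
  have hσ1 := hExp.sigma1_pos
  have hσ0 := hExp.sigma0_pos
  have hn0 : (n : ℝ) ≠ 0 := Nat.cast_ne_zero.2 (Nat.one_le_iff_ne_zero.1 hn)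
  have hval : σ1 ^ 2 / (σ1 / (σ1 + σ0)) + σ0 ^ 2 / (1 - σ1 / (σ1 + σ0)) = (σ1 + σ0) ^ 2 := by
    have hsub : 1 - σ1 / (σ1 + σ0) = σ0 / (σ1 + σ0) := by
      field_simp
      ring
    rw [hsub]
    field_simp
  rw [hExp.integral_tauHat2_sub_sq]
  simp only [he, hval, integral_const, probReal_univ, one_smul, Finset.sum_const,
    Finset.card_univ, Fintype.card_fin, nsmul_eq_mul]
  field_simp

end AdaptiveExperiment
end

section
/- Corollary (Neyman allocation is a universal variance lower bound): Let τ̂ be an estimator that is unbiased for every Gaussian two-arm instance, i.e. E_{(μ⁽¹⁾,μ⁽⁰⁾,σ⁽¹⁾,σ⁽⁰⁾)}[τ̂] = μ⁽¹⁾ − μ⁽⁰⁾ for all μ⁽¹⁾, μ⁽⁰⁾ ∈ ℝ and σ⁽¹⁾, σ⁽⁰⁾ > 0, under any fixed non-anticipating allocation mechanism. Then for every instance, Var(τ̂) ≥ (σ⁽¹⁾ + σ⁽⁰⁾)²/n. -/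
open MeasureTheory ProbabilityTheory
open scoped ENNReal

namespace LowerBound

/-- Extension of a finite vector to `ℕ` (by junk values), used to feed the finitely many
randomization variables into the trajectory construction. -/
def ext (n : ℕ) (f : Fin n → ℝ) : ℕ → ℝ := fun j => if h : j < n then f ⟨j, h⟩ else 0

/-- The trajectory of a sequential experiment run by a non-anticipating allocation
mechanism `a` on the Gaussian two-arm instance `(μ1, μ0, σ1, σ0)`: unit `i` receives
treatment `Wᵢ = a i (history) (uᵢ)` (where `uᵢ` is exogenous uniform randomization,
so that `a` represents an arbitrary Markov kernel given the history), and the observed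
outcome is `Yᵢ = μ^{(Wᵢ)} + σ^{(Wᵢ)}·zᵢ` with `zᵢ` standard Gaussian. -/
noncomputable def traj (a : (i : ℕ) → (Fin i → Bool × ℝ) → ℝ → Bool)
    (μ1 μ0 σ1 σ0 : ℝ) (u z : ℕ → ℝ) : (i : ℕ) → Bool × ℝ := fun i =>
  Nat.strongRecOn i (fun i ih =>
    let w := a i (fun j : Fin i => ih j j.isLt) (u i)
    (w, if w then μ1 + σ1 * z i else μ0 + σ0 * z i))

/-- The canonical probability space carrying the exogenous randomness: `n` i.i.d.
uniform variables on `[0,1]` (for the allocation mechanism) and `n` i.i.d. standard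
Gaussians (for the outcomes). -/
noncomputable def Pbase (n : ℕ) : Measure ((Fin n → ℝ) × (Fin n → ℝ)) :=
  (Measure.pi fun _ : Fin n => volume.restrict (Set.Icc (0 : ℝ) 1)).prod
    (Measure.pi fun _ : Fin n => gaussianReal 0 1)

/-- The collected data `𝓕ₙ = (W₁, Y₁, …, Wₙ, Yₙ)` of the experiment. -/
noncomputable def data (n : ℕ) (a : (i : ℕ) → (Fin i → Bool × ℝ) → ℝ → Bool)
    (μ1 μ0 σ1 σ0 : ℝ) (ω : (Fin n → ℝ) × (Fin n → ℝ)) : Fin n → Bool × ℝ :=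
  fun i => traj a μ1 μ0 σ1 σ0 (ext n ω.1) (ext n ω.2) i

/-- The treatment and outcome of the next unit, given the history `h` and fresh noise `p`. -/
noncomputable def step (n : ℕ) (a : (i : ℕ) → (Fin i → Bool × ℝ) → ℝ → Bool)
    (μ1 μ0 σ1 σ0 : ℝ) (h : Fin n → Bool × ℝ) (p : ℝ × ℝ) : Bool × ℝ :=
  (a n h p.1, if a n h p.1 then μ1 + σ1 * p.2 else μ0 + σ0 * p.2)

/-- The signed standardized residual of one observation. -/
noncomputable def residual (μ1 μ0 σ1 σ0 : ℝ) (p : Bool × ℝ) : ℝ :=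
  if p.1 then (p.2 - μ1) / σ1 else -((p.2 - μ0) / σ0)

/-- The likelihood ratio between the instances `(μ1 + t σ1, μ0 - t σ0, σ1, σ0)` and
`(μ1, μ0, σ1, σ0)`, evaluated on the collected data. -/
noncomputable def likelihoodRatio (n : ℕ) (μ1 μ0 σ1 σ0 t : ℝ) (h : Fin n → Bool × ℝ) : ℝ :=
  Real.exp (t * ∑ i, residual μ1 μ0 σ1 σ0 (h i) - n * t ^ 2 / 2)

section Trajectory

variable (a : (i : ℕ) → (Fin i → Bool × ℝ) → ℝ → Bool) (μ1 μ0 σ1 σ0 : ℝ)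

lemma traj_eq (u z : ℕ → ℝ) (i : ℕ) :
    traj a μ1 μ0 σ1 σ0 u z i =
      step i a μ1 μ0 σ1 σ0 (fun j : Fin i => traj a μ1 μ0 σ1 σ0 u z j) (u i, z i) := by
  unfold traj
  rw [Nat.strongRecOn_eq]
  rfl

lemma traj_congr {u z u' z' : ℕ → ℝ} (i : ℕ) (hu : ∀ j ≤ i, u j = u' j)
    (hz : ∀ j ≤ i, z j = z' j) :
    traj a μ1 μ0 σ1 σ0 u z i = traj a μ1 μ0 σ1 σ0 u' z' i := by
  induction i using Nat.strong_induction_on with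
  | _ i ih =>
    rw [traj_eq, traj_eq, hu i le_rfl, hz i le_rfl]
    congr 1
    funext j
    exact ih j j.isLt (fun k hk => hu k (hk.trans j.isLt.le)) fun k hk => hz k (hk.trans j.isLt.le)

lemma ext_snoc_of_lt {n : ℕ} (u : Fin n → ℝ) (x : ℝ) {j : ℕ} (hj : j < n) :
    ext (n + 1) (Fin.snoc (α := fun _ => ℝ) u x) j = ext n u j := by
  have : (⟨j, by omega⟩ : Fin (n + 1)) = Fin.castSucc ⟨j, hj⟩ := rfl
  simp only [ext, hj, Nat.lt_succ_of_lt hj, dif_pos]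
  rw [this, Fin.snoc_castSucc]

lemma ext_snoc_self {n : ℕ} (u : Fin n → ℝ) (x : ℝ) :
    ext (n + 1) (Fin.snoc (α := fun _ => ℝ) u x) n = x := by
  have : (⟨n, by omega⟩ : Fin (n + 1)) = Fin.last n := rfl
  simp only [ext, Nat.lt_succ_self, dif_pos]
  rw [this, Fin.snoc_last]

lemma data_snoc (n : ℕ) (u z : Fin n → ℝ) (x y : ℝ) :
    data (n + 1) a μ1 μ0 σ1 σ0
        (Fin.snoc (α := fun _ => ℝ) u x, Fin.snoc (α := fun _ => ℝ) z y) =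
      Fin.snoc (α := fun _ => Bool × ℝ) (data n a μ1 μ0 σ1 σ0 (u, z))
        (step n a μ1 μ0 σ1 σ0 (data n a μ1 μ0 σ1 σ0 (u, z)) (x, y)) := by
  have key (j : ℕ) (hj : j < n) :
      traj a μ1 μ0 σ1 σ0 (ext (n + 1) (Fin.snoc (α := fun _ => ℝ) u x))
        (ext (n + 1) (Fin.snoc (α := fun _ => ℝ) z y)) j =
      traj a μ1 μ0 σ1 σ0 (ext n u) (ext n z) j :=
    traj_congr a μ1 μ0 σ1 σ0 j (fun k hk => ext_snoc_of_lt u x (hk.trans_lt hj))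
      fun k hk => ext_snoc_of_lt z y (hk.trans_lt hj)
  funext i
  refine Fin.lastCases ?_ (fun j => ?_) i
  · rw [Fin.snoc_last]
    simp only [data, Fin.val_last]
    rw [traj_eq, ext_snoc_self, ext_snoc_self]
    congr 1
    funext j
    exact key j j.isLt
  · rw [Fin.snoc_castSucc]
    exact key j j.isLt

end Trajectory

section Measurability

lemma measurable_snoc {α : Type*} [MeasurableSpace α] (n : ℕ) :
    Measurable fun p : (Fin n → α) × α =>
      (Fin.snoc (α := fun _ => α) p.1 p.2 : Fin (n + 1) → α) := by
  refine measurable_pi_lambda _ fun i => ?_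
  refine Fin.lastCases ?_ (fun j => ?_) i
  · simpa using measurable_snd
  · simpa [Function.comp_def] using (measurable_pi_apply j).comp measurable_fst

variable {a : (i : ℕ) → (Fin i → Bool × ℝ) → ℝ → Bool}

lemma measurable_step (ha : ∀ i, Measurable fun p : (Fin i → Bool × ℝ) × ℝ => a i p.1 p.2)
    (n : ℕ) (μ1 μ0 σ1 σ0 : ℝ) :
    Measurable fun q : (Fin n → Bool × ℝ) × (ℝ × ℝ) => step n a μ1 μ0 σ1 σ0 q.1 q.2 := by
  have hw : Measurable fun q : (Fin n → Bool × ℝ) × (ℝ × ℝ) => a n q.1 q.2.1 :=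
    (ha n).comp (measurable_fst.prodMk (measurable_fst.comp measurable_snd))
  refine hw.prodMk (Measurable.ite (hw (measurableSet_singleton true)) ?_ ?_) <;> fun_prop

lemma measurable_ext (n j : ℕ) : Measurable fun f : Fin n → ℝ => ext n f j := by
  unfold ext
  split_ifs <;> fun_prop

lemma measurable_data (ha : ∀ i, Measurable fun p : (Fin i → Bool × ℝ) × ℝ => a i p.1 p.2)
    (n : ℕ) (μ1 μ0 σ1 σ0 : ℝ) : Measurable (data n a μ1 μ0 σ1 σ0) := by
  have key (i : ℕ) : Measurable fun ω : (Fin n → ℝ) × (Fin n → ℝ) =>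
      traj a μ1 μ0 σ1 σ0 (ext n ω.1) (ext n ω.2) i := by
    induction i using Nat.strong_induction_on with
    | _ i ih =>
      simp_rw [traj_eq a μ1 μ0 σ1 σ0 _ _ i]
      exact (measurable_step ha i μ1 μ0 σ1 σ0).comp
        ((measurable_pi_lambda _ fun j : Fin i => ih j j.isLt).prodMk
          (((measurable_ext n i).comp measurable_fst).prodMk
            ((measurable_ext n i).comp measurable_snd)))
  exact measurable_pi_lambda _ fun i => key i

lemma measurable_residual (μ1 μ0 σ1 σ0 : ℝ) : Measurable (residual μ1 μ0 σ1 σ0) := by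
  refine Measurable.ite (measurable_fst (measurableSet_singleton true)) ?_ ?_ <;> fun_prop

lemma measurable_likelihoodRatio (n : ℕ) (μ1 μ0 σ1 σ0 t : ℝ) :
    Measurable (likelihoodRatio n μ1 μ0 σ1 σ0 t) := by
  have := measurable_residual μ1 μ0 σ1 σ0
  unfold likelihoodRatio
  fun_prop

end Measurability

section BaseMeasure

lemma measurePreserving_snoc (n : ℕ) (μ : Measure ℝ) [SigmaFinite μ] :
    MeasurePreserving
      (fun p : (Fin n → ℝ) × ℝ => (Fin.snoc (α := fun _ => ℝ) p.1 p.2 : Fin (n + 1) → ℝ))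
      ((Measure.pi fun _ : Fin n => μ).prod μ) (Measure.pi fun _ : Fin (n + 1) => μ) := by
  have h := (measurePreserving_piFinSuccAbove (fun _ : Fin (n + 1) => μ) (Fin.last n)).symm.comp
    (Measure.measurePreserving_swap (μ := Measure.pi fun _ : Fin n => μ) (ν := μ))
  convert h using 1
  funext p
  exact (Fin.insertNth_last' p.2 p.1).symm

instance : IsProbabilityMeasure (volume.restrict (Set.Icc (0 : ℝ) 1)) := ⟨by simp⟩

instance (n : ℕ) : IsProbabilityMeasure (Pbase n) := by
  unfold Pbase
  infer_instance

lemma lintegral_Pbase_succ (n : ℕ) {f : (Fin (n + 1) → ℝ) × (Fin (n + 1) → ℝ) → ℝ≥0∞}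
    (hf : Measurable f) :
    ∫⁻ ω, f ω ∂(Pbase (n + 1)) = ∫⁻ ω, (∫⁻ x in Set.Icc (0 : ℝ) 1, (∫⁻ y,
      f (Fin.snoc (α := fun _ => ℝ) ω.1 x, Fin.snoc (α := fun _ => ℝ) ω.2 y)
        ∂(gaussianReal 0 1))) ∂(Pbase n) := by
  have h := (measurePreserving_snoc n (volume.restrict (Set.Icc (0 : ℝ) 1))).prod
    (measurePreserving_snoc n (gaussianReal 0 1))
  have hs := measurable_snoc (α := ℝ) n
  have hg : Measurable fun q : (((Fin n → ℝ) × (Fin n → ℝ)) × ℝ) × ℝ =>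
      f (Fin.snoc (α := fun _ => ℝ) q.1.1.1 q.1.2, Fin.snoc (α := fun _ => ℝ) q.1.1.2 q.2) := by
    fun_prop
  have hg' := hg.lintegral_prod_right' (ν := gaussianReal 0 1)
  have hg'' := hg'.lintegral_prod_right' (ν := volume.restrict (Set.Icc (0 : ℝ) 1))
  have hfs := hf.comp h.measurable
  calc ∫⁻ ω, f ω ∂(Pbase (n + 1))
      = ∫⁻ p, (f ∘ Prod.map _ _) p ∂_ := (h.lintegral_comp hf).symm
    _ = _ := by
      rw [lintegral_prod _ hfs.aemeasurable, Pbase, lintegral_prod _ hg''.aemeasurable,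
        lintegral_prod _ hfs.lintegral_prod_right'.aemeasurable]
      refine lintegral_congr fun u => ?_
      have hu : Measurable fun q : (Fin n → ℝ) × ℝ => ((u, q.1), q.2) := by fun_prop
      refine Eq.trans ?_ (lintegral_lintegral_swap
        (μ := Measure.pi fun _ : Fin n => gaussianReal 0 1)
        (ν := volume.restrict (Set.Icc (0 : ℝ) 1)) (f := fun z x => ∫⁻ y,
          f (Fin.snoc (α := fun _ => ℝ) u x, Fin.snoc (α := fun _ => ℝ) z y) ∂(gaussianReal 0 1))
        (hg'.comp hu).aemeasurable).symm
      refine lintegral_congr fun x => ?_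
      exact lintegral_prod _ (hfs.comp (measurable_prodMk_left (x := (u, x)))).aemeasurable

lemma lintegral_gaussianReal_add (c : ℝ) {g : ℝ → ℝ≥0∞} (hg : Measurable g) :
    ∫⁻ z, g (z + c) ∂(gaussianReal 0 1) =
      ∫⁻ z, g z * ENNReal.ofReal (Real.exp (c * z - c ^ 2 / 2)) ∂(gaussianReal 0 1) := by
  rw [← lintegral_map (f := g) hg (measurable_add_const c), gaussianReal_map_add_const,
    gaussianReal_of_var_ne_zero _ one_ne_zero, gaussianReal_of_var_ne_zero _ one_ne_zero,
    lintegral_withDensity_eq_lintegral_mul _ (measurable_gaussianPDF _ _) hg,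
    lintegral_withDensity_eq_lintegral_mul _ (measurable_gaussianPDF _ _) (by fun_prop)]
  refine lintegral_congr fun z => ?_
  simp only [Pi.mul_apply, gaussianPDF]
  rw [mul_left_comm, ← ENNReal.ofReal_mul (gaussianPDFReal_nonneg _ _ _), mul_comm]
  congr 2
  simp only [gaussianPDFReal, NNReal.coe_one]
  rw [mul_assoc _ (Real.exp _), ← Real.exp_add]
  congr 2
  ring

end BaseMeasure

section ChangeOfMeasure

variable {a : (i : ℕ) → (Fin i → Bool × ℝ) → ℝ → Bool} {μ1 μ0 σ1 σ0 : ℝ}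

lemma likelihoodRatio_snoc (n : ℕ) (t : ℝ) (h : Fin n → Bool × ℝ) (p : Bool × ℝ) :
    likelihoodRatio (n + 1) μ1 μ0 σ1 σ0 t (Fin.snoc (α := fun _ => Bool × ℝ) h p) =
      likelihoodRatio n μ1 μ0 σ1 σ0 t h *
        Real.exp (t * residual μ1 μ0 σ1 σ0 p - t ^ 2 / 2) := by
  simp only [likelihoodRatio, Fin.sum_univ_castSucc, Fin.snoc_castSucc, Fin.snoc_last]
  rw [← Real.exp_add]
  congr 1
  push_cast
  ring

lemma lintegral_step (hσ1 : 0 < σ1) (hσ0 : 0 < σ0) (n : ℕ) (t : ℝ) (h : Fin n → Bool × ℝ)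
    (x : ℝ) {g : Bool × ℝ → ℝ≥0∞} (hg : Measurable g) :
    ∫⁻ y, g (step n a (μ1 + t * σ1) (μ0 - t * σ0) σ1 σ0 h (x, y)) ∂(gaussianReal 0 1) =
      ∫⁻ y, g (step n a μ1 μ0 σ1 σ0 h (x, y)) *
        ENNReal.ofReal (Real.exp (t * residual μ1 μ0 σ1 σ0 (step n a μ1 μ0 σ1 σ0 h (x, y))
          - t ^ 2 / 2)) ∂(gaussianReal 0 1) := by
  rcases hw : a n h x with _ | _
  · have := lintegral_gaussianReal_add (-t) (g := fun y => g (false, μ0 + σ0 * y)) (by fun_prop)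
    simp only [step, residual, hw, Bool.false_eq_true, if_false]
    convert this using 5 with y y
    · ring
    · rw [add_sub_cancel_left, mul_div_cancel_left₀ _ hσ0.ne']
      ring_nf
  · have := lintegral_gaussianReal_add t (g := fun y => g (true, μ1 + σ1 * y)) (by fun_prop)
    simp only [step, residual, hw, if_true]
    convert this using 5 with y y
    · ring
    · rw [add_sub_cancel_left, mul_div_cancel_left₀ _ hσ1.ne']

lemma lintegral_data_eq (ha : ∀ i, Measurable fun p : (Fin i → Bool × ℝ) × ℝ => a i p.1 p.2)
    (hσ1 : 0 < σ1) (hσ0 : 0 < σ0) (t : ℝ) (n : ℕ) {f : (Fin n → Bool × ℝ) → ℝ≥0∞}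
    (hf : Measurable f) :
    ∫⁻ ω, f (data n a (μ1 + t * σ1) (μ0 - t * σ0) σ1 σ0 ω) ∂(Pbase n) =
      ∫⁻ ω, f (data n a μ1 μ0 σ1 σ0 ω) *
        ENNReal.ofReal (likelihoodRatio n μ1 μ0 σ1 σ0 t (data n a μ1 μ0 σ1 σ0 ω)) ∂(Pbase n) := by
  induction n with
  | zero =>
    refine lintegral_congr fun ω => ?_
    rw [Subsingleton.elim (data 0 a (μ1 + t * σ1) (μ0 - t * σ0) σ1 σ0 ω)
      (data 0 a μ1 μ0 σ1 σ0 ω)]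
    simp [likelihoodRatio]
  | succ n ih =>
    have hL := measurable_likelihoodRatio (n + 1) μ1 μ0 σ1 σ0 t
    have hsnoc := measurable_snoc (α := Bool × ℝ) n
    have hstep := measurable_step ha n (μ1 + t * σ1) (μ0 - t * σ0) σ1 σ0
    rw [lintegral_Pbase_succ n (f := fun ω => f (data (n + 1) a _ _ _ _ ω))
        (hf.comp (measurable_data ha _ _ _ _ _)),
      lintegral_Pbase_succ n (by have := measurable_data ha (n + 1) μ1 μ0 σ1 σ0; fun_prop)]
    simp only [data_snoc, Prod.mk.eta]
    rw [ih (f := fun h => ∫⁻ x in Set.Icc (0 : ℝ) 1, ∫⁻ y,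
      f (Fin.snoc (α := fun _ => Bool × ℝ) h
        (step n a (μ1 + t * σ1) (μ0 - t * σ0) σ1 σ0 h (x, y))) ∂(gaussianReal 0 1)) ?_]
    · refine lintegral_congr fun ω => ?_
      generalize data n a μ1 μ0 σ1 σ0 ω = h
      rw [← lintegral_mul_const' _ _ ENNReal.ofReal_ne_top]
      refine lintegral_congr fun x => ?_
      rw [lintegral_step hσ1 hσ0 n t h x (g := fun p => f (Fin.snoc (α := fun _ => Bool × ℝ) h p))
        (by fun_prop), ← lintegral_mul_const' _ _ ENNReal.ofReal_ne_top]
      refine lintegral_congr fun y => ?_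
      rw [likelihoodRatio_snoc, ENNReal.ofReal_mul' (Real.exp_pos _).le, mul_assoc,
        mul_comm (ENNReal.ofReal (Real.exp _))]
    · refine Measurable.lintegral_prod_right' (f := fun q : (Fin n → Bool × ℝ) × ℝ => ∫⁻ y,
        f (Fin.snoc (α := fun _ => Bool × ℝ) q.1
          (step n a (μ1 + t * σ1) (μ0 - t * σ0) σ1 σ0 q.1 (q.2, y))) ∂(gaussianReal 0 1)) ?_
      refine Measurable.lintegral_prod_right' (f := fun r : ((Fin n → Bool × ℝ) × ℝ) × ℝ =>
        f (Fin.snoc (α := fun _ => Bool × ℝ) r.1.1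
          (step n a (μ1 + t * σ1) (μ0 - t * σ0) σ1 σ0 r.1.1 (r.1.2, r.2)))) ?_
      have : Measurable fun r : ((Fin n → Bool × ℝ) × ℝ) × ℝ =>
        step n a (μ1 + t * σ1) (μ0 - t * σ0) σ1 σ0 r.1.1 (r.1.2, r.2) :=
        hstep.comp (by fun_prop : Measurable fun r : ((Fin n → Bool × ℝ) × ℝ) × ℝ =>
          (r.1.1, (r.1.2, r.2)))
      fun_prop

lemma likelihoodRatio_sq (n : ℕ) (t : ℝ) (h : Fin n → Bool × ℝ) :
    likelihoodRatio n μ1 μ0 σ1 σ0 t h ^ 2 =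
      likelihoodRatio n μ1 μ0 σ1 σ0 (2 * t) h * Real.exp (n * t ^ 2) := by
  simp only [likelihoodRatio]
  rw [← Real.exp_add, ← Real.exp_nat_mul]
  congr 1
  push_cast
  ring

lemma integrable_and_integral_likelihoodRatio
    (ha : ∀ i, Measurable fun p : (Fin i → Bool × ℝ) × ℝ => a i p.1 p.2)
    (hσ1 : 0 < σ1) (hσ0 : 0 < σ0) (t : ℝ) (n : ℕ) :
    Integrable (fun ω => likelihoodRatio n μ1 μ0 σ1 σ0 t (data n a μ1 μ0 σ1 σ0 ω)) (Pbase n) ∧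
      ∫ ω, likelihoodRatio n μ1 μ0 σ1 σ0 t (data n a μ1 μ0 σ1 σ0 ω) ∂(Pbase n) = 1 := by
  have h := lintegral_data_eq (μ1 := μ1) (μ0 := μ0) ha hσ1 hσ0 t n (f := fun _ => 1)
    measurable_const
  simp only [lintegral_const, measure_univ, one_mul] at h
  have hm := (measurable_likelihoodRatio n μ1 μ0 σ1 σ0 t).comp (measurable_data ha n μ1 μ0 σ1 σ0)
  have hnn : 0 ≤ᵐ[Pbase n] fun ω =>
      likelihoodRatio n μ1 μ0 σ1 σ0 t (data n a μ1 μ0 σ1 σ0 ω) :=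
    ae_of_all _ fun ω => (Real.exp_pos _).le
  refine ⟨(lintegral_ofReal_ne_top_iff_integrable hm.aestronglyMeasurable hnn).1
    (by simp [← h]), ?_⟩
  rw [integral_eq_lintegral_of_nonneg_ae hnn hm.aestronglyMeasurable, ← h, ENNReal.toReal_one]

lemma map_data_eq_withDensity
    (ha : ∀ i, Measurable fun p : (Fin i → Bool × ℝ) × ℝ => a i p.1 p.2)
    (hσ1 : 0 < σ1) (hσ0 : 0 < σ0) (t : ℝ) (n : ℕ) :
    (Pbase n).map (data n a (μ1 + t * σ1) (μ0 - t * σ0) σ1 σ0) =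
      ((Pbase n).map (data n a μ1 μ0 σ1 σ0)).withDensity
        fun h => ENNReal.ofReal (likelihoodRatio n μ1 μ0 σ1 σ0 t h) := by
  have hL := measurable_likelihoodRatio n μ1 μ0 σ1 σ0 t
  refine Measure.ext_of_lintegral _ fun f hf => ?_
  rw [lintegral_map hf (measurable_data ha _ _ _ _ _), lintegral_data_eq ha hσ1 hσ0 t n hf,
    lintegral_withDensity_eq_lintegral_mul _ (by fun_prop) hf,
    lintegral_map (by fun_prop) (measurable_data ha _ _ _ _ _)]
  refine lintegral_congr fun ω => ?_
  rw [Pi.mul_apply, mul_comm]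

lemma integrable_and_integral_data_eq
    (ha : ∀ i, Measurable fun p : (Fin i → Bool × ℝ) × ℝ => a i p.1 p.2)
    (hσ1 : 0 < σ1) (hσ0 : 0 < σ0) (t : ℝ) (n : ℕ) {T : (Fin n → Bool × ℝ) → ℝ}
    (hT : Measurable T)
    (hTint : Integrable (fun ω => T (data n a (μ1 + t * σ1) (μ0 - t * σ0) σ1 σ0 ω)) (Pbase n)) :
    Integrable (fun ω => likelihoodRatio n μ1 μ0 σ1 σ0 t (data n a μ1 μ0 σ1 σ0 ω) *
        T (data n a μ1 μ0 σ1 σ0 ω)) (Pbase n) ∧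
      ∫ ω, likelihoodRatio n μ1 μ0 σ1 σ0 t (data n a μ1 μ0 σ1 σ0 ω) *
        T (data n a μ1 μ0 σ1 σ0 ω) ∂(Pbase n) =
      ∫ ω, T (data n a (μ1 + t * σ1) (μ0 - t * σ0) σ1 σ0 ω) ∂(Pbase n) := by
  have hL := measurable_likelihoodRatio n μ1 μ0 σ1 σ0 t
  have hd := measurable_data ha n μ1 μ0 σ1 σ0
  have hd' := measurable_data ha n (μ1 + t * σ1) (μ0 - t * σ0) σ1 σ0
  have hnn (h) : 0 ≤ likelihoodRatio n μ1 μ0 σ1 σ0 t h := (Real.exp_pos _).le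
  have hmap := map_data_eq_withDensity (μ1 := μ1) (μ0 := μ0) ha hσ1 hσ0 t n
  constructor
  · have h1 := (integrable_map_measure hT.aestronglyMeasurable hd'.aemeasurable).2 hTint
    rw [hmap, integrable_withDensity_iff_integrable_smul' (by fun_prop)
      (ae_of_all _ fun _ => ENNReal.ofReal_lt_top)] at h1
    simp only [ENNReal.toReal_ofReal (hnn _), smul_eq_mul] at h1
    exact h1.comp_measurable hd
  · rw [← integral_map (f := T) hd'.aemeasurable hT.aestronglyMeasurable, hmap,
      integral_withDensity_eq_integral_toReal_smul (by fun_prop)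
        (ae_of_all _ fun _ => ENNReal.ofReal_lt_top),
      integral_map hd.aemeasurable (by fun_prop)]
    simp only [ENNReal.toReal_ofReal (hnn _), smul_eq_mul]

end ChangeOfMeasure

/-- A Chapman–Robbins type bound, in linearized form. -/
lemma two_mul_integral_le_variance {Ω : Type*} [MeasurableSpace Ω] {P : Measure Ω}
    [IsProbabilityMeasure P] {X L : Ω → ℝ} (hX : MemLp X 2 P) (hL : MemLp L 2 P)
    (hL1 : ∫ ω, L ω ∂P = 1) (c : ℝ) :
    2 * c * (∫ ω, L ω * X ω ∂P - ∫ ω, X ω ∂P) ≤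
      c ^ 2 * variance X P + (∫ ω, L ω ^ 2 ∂P - 1) := by
  have hvar := variance_nonneg (fun ω => L ω - c * X ω) P
  have h1 : variance (fun ω => L ω - c * X ω) P =
      variance L P + variance (fun ω => c * X ω) P - 2 * cov[L, fun ω => c * X ω; P] := by
    have := variance_sub hL (hX.const_mul c)
    simp only [Pi.sub_def] at this
    linarith
  rw [h1, variance_const_mul, covariance_const_mul_right, variance_eq_sub hL,
    covariance_eq_sub hL hX, hL1] at hvar
  simp only [Pi.mul_apply, Pi.pow_apply] at hvar
  linarith

/-- Neyman allocation is a universal variance lower bound: if an estimator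
`T` of the data collected by a fixed non-anticipating allocation mechanism is unbiased for
every Gaussian two-arm instance, then on every instance its variance is at least
`(σ⁽¹⁾+σ⁽⁰⁾)²/n`. -/
theorem statement_7 (n : ℕ) (hn : 1 ≤ n)
    (a : (i : ℕ) → (Fin i → Bool × ℝ) → ℝ → Bool)
    (ha : ∀ i, Measurable fun p : (Fin i → Bool × ℝ) × ℝ => a i p.1 p.2)
    (T : (Fin n → Bool × ℝ) → ℝ) (hT : Measurable T)
    -- `T` is unbiased on every instance
    (hunbiased : ∀ μ1 μ0 σ1 σ0 : ℝ, 0 < σ1 → 0 < σ0 →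
      Integrable (fun ω => T (data n a μ1 μ0 σ1 σ0 ω)) (Pbase n) ∧
      ∫ ω, T (data n a μ1 μ0 σ1 σ0 ω) ∂(Pbase n) = μ1 - μ0) :
    ∀ μ1 μ0 σ1 σ0 : ℝ, 0 < σ1 → 0 < σ0 →
      ENNReal.ofReal ((σ1 + σ0) ^ 2 / n) ≤
        evariance (fun ω => T (data n a μ1 μ0 σ1 σ0 ω)) (Pbase n) := by
  intro μ1 μ0 σ1 σ0 hσ1 hσ0
  have hd := measurable_data ha n μ1 μ0 σ1 σ0
  rcases eq_top_or_lt_top (evariance (fun ω => T (data n a μ1 μ0 σ1 σ0 ω)) (Pbase n))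
    with htop | hlt
  · rw [htop]
    exact le_top
  have hX : MemLp (fun ω => T (data n a μ1 μ0 σ1 σ0 ω)) 2 (Pbase n) :=
    (evariance_lt_top_iff_memLp (hT.comp hd).aestronglyMeasurable).1 hlt
  rw [← hX.ofReal_variance_eq]
  refine ENNReal.ofReal_le_ofReal ?_
  set V := variance (fun ω => T (data n a μ1 μ0 σ1 σ0 ω)) (Pbase n)
  have hn0 : (0 : ℝ) < n := by exact_mod_cast hn
  have hs : 0 < σ1 + σ0 := add_pos hσ1 hσ0
  have bound (t c : ℝ) : 2 * c * (t * (σ1 + σ0)) ≤ c ^ 2 * V + (Real.exp (n * t ^ 2) - 1) := by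
    obtain ⟨-, hL1⟩ :=
      integrable_and_integral_likelihoodRatio (μ1 := μ1) (μ0 := μ0) ha hσ1 hσ0 t n
    obtain ⟨hI2, hL2⟩ :=
      integrable_and_integral_likelihoodRatio (μ1 := μ1) (μ0 := μ0) ha hσ1 hσ0 (2 * t) n
    have hLm : MemLp (fun ω => likelihoodRatio n μ1 μ0 σ1 σ0 t (data n a μ1 μ0 σ1 σ0 ω)) 2
        (Pbase n) := by
      refine (memLp_two_iff_integrable_sq
        ((measurable_likelihoodRatio n μ1 μ0 σ1 σ0 t).comp hd).aestronglyMeasurable).2 ?_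
      exact (hI2.mul_const (Real.exp (n * t ^ 2))).congr
        (ae_of_all _ fun ω => (likelihoodRatio_sq n t _).symm)
    have h := two_mul_integral_le_variance hX hLm hL1 c
    simp only [likelihoodRatio_sq] at h
    rw [integral_mul_const, hL2, one_mul,
      (integrable_and_integral_data_eq ha hσ1 hσ0 t n hT (hunbiased _ _ _ _ hσ1 hσ0).1).2,
      (hunbiased _ _ _ _ hσ1 hσ0).2, (hunbiased _ _ _ _ hσ1 hσ0).2] at h
    linarith
  have key (x : ℝ) (hx : 0 < x) (hx1 : x ≤ 1) : 1 - x ≤ n * V / (σ1 + σ0) ^ 2 := by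
    have h := bound √(x / n) (n * √(x / n) / (σ1 + σ0))
    have hsq : √(x / n) ^ 2 = x / n := Real.sq_sqrt (by positivity)
    have e1 : 2 * (n * √(x / n) / (σ1 + σ0)) * (√(x / n) * (σ1 + σ0)) = 2 * x := by
      calc _ = 2 * n * √(x / n) ^ 2 := by field_simp
        _ = 2 * x := by rw [hsq]; field_simp
    have e2 : (n * √(x / n) / (σ1 + σ0)) ^ 2 * V = x * (n * V / (σ1 + σ0) ^ 2) := by
      rw [div_pow, mul_pow, hsq]
      field_simp
    have e3 : (n : ℝ) * √(x / n) ^ 2 = x := by rw [hsq]; field_simp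
    rw [e1, e2, e3] at h
    have hexp := (abs_le.1 (Real.abs_exp_sub_one_sub_id_le (abs_le.2 ⟨by linarith, hx1⟩))).2
    refine le_of_mul_le_mul_left ?_ hx
    linarith
  have hone : 1 ≤ n * V / (σ1 + σ0) ^ 2 := by
    refine le_of_forall_pos_le_add fun ε hε => ?_
    have := key (min ε 1) (lt_min hε one_pos) (min_le_right _ _)
    linarith [min_le_left ε 1]
  rw [le_div_iff₀ (by positivity), one_mul] at hone
  rw [div_le_iff₀ hn0]
  linarith

end LowerBound
end
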